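/- arXiv:2503.00694 — 2 statements merged into one kernel-verified Lean document; each statement's English description precedes it below -/
import Mathlib

section
/- Let γ > 0 and 0 ≤ α ≤ γ be reals, let N ≥ 3 be an integer, let E > 0 and E_1 ≥ E_2 ≥ ⋯ ≥ E_{N−1} > 0 be real numbers satisfying E^γ ≥ ∑_{i=1}^{N−1} E_i^γ. Set q = max over h = 1, …, N−2 of h·E_{h+1}^γ/(E_1^γ + ⋯ + E_h^γ), and let s be real with q ≤ s ≤ 1. Then E^α ≥ ∑_{k=1}^{N−2} (1 + (k−1)/s)^(α/γ − 1) · ∏_{j=2}^{N−k} (1 + s/(N−j))^(α/γ − 1) · E_k^α + (1 + (N−2)/s)^(α/γ − 1) · E_{N−1}^α. -/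
open Real Finset

/-- Two-term reverse Hölder bound coming from concavity of `t ↦ t ^ x`, for conjugate `u`, `v`. -/
theorem rpow_sub_one_mul_add_le_add_rpow {x u v a b : ℝ} (hx0 : 0 ≤ x) (hx1 : x ≤ 1)
    (hu : 0 < u) (hv : 0 < v) (huv : u⁻¹ + v⁻¹ = 1) (ha : 0 ≤ a) (hb : 0 ≤ b) :
    u ^ (x - 1) * a ^ x + v ^ (x - 1) * b ^ x ≤ (a + b) ^ x := by
  have key := (Real.concaveOn_rpow hx0 hx1).2 (Set.mem_Ici.2 (mul_nonneg hu.le ha))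
    (Set.mem_Ici.2 (mul_nonneg hv.le hb)) (inv_nonneg.2 hu.le) (inv_nonneg.2 hv.le) huv
  simp only [smul_eq_mul, inv_mul_cancel_left₀ hu.ne', inv_mul_cancel_left₀ hv.ne',
    Real.mul_rpow hu.le ha, Real.mul_rpow hv.le hb] at key
  rw [Real.rpow_sub_one hu.ne', Real.rpow_sub_one hv.ne']
  calc _ = u⁻¹ * (u ^ x * a ^ x) + v⁻¹ * (v ^ x * b ^ x) := by ring
    _ ≤ _ := key

/-- Iterated lower bound for the `x`-th power (`0 ≤ x ≤ 1`) of a sum of nonnegative reals. -/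
theorem sum_weighted_rpow_le_rpow_sum {x s : ℝ} (hx0 : 0 ≤ x) (hx1 : x ≤ 1) (hs : 0 < s)
    (a : ℕ → ℝ) {m : ℕ} (hm : 1 ≤ m) (ha : ∀ i, 1 ≤ i → i ≤ m → 0 ≤ a i) :
    ∑ k ∈ Icc 1 m, (1 + ((k : ℝ) - 1) / s) ^ (x - 1) *
        (∏ h ∈ Ico k m, (1 + s / (h : ℝ)) ^ (x - 1)) * a k ^ x ≤
      (∑ i ∈ Icc 1 m, a i) ^ x := by
  induction m, hm using Nat.le_induction with
  | base => simp
  | succ m hm ih =>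
    have hm0 : (0 : ℝ) < m := by exact_mod_cast hm
    have hstep := rpow_sub_one_mul_add_le_add_rpow hx0 hx1
      (u := 1 + s / m) (v := 1 + m / s) (by positivity) (by positivity) (by field_simp; ring)
      (sum_nonneg fun i hi => ha i (mem_Icc.1 hi).1 ((mem_Icc.1 hi).2.trans m.le_succ))
      (ha (m + 1) (by lia) le_rfl)
    rw [sum_Icc_succ_top (by lia), sum_Icc_succ_top (by lia)]
    refine le_trans (add_le_add ?_ (by simp)) hstep
    calc _ = (1 + s / (m : ℝ)) ^ (x - 1) * ∑ k ∈ Icc 1 m, (1 + ((k : ℝ) - 1) / s) ^ (x - 1) *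
          (∏ h ∈ Ico k m, (1 + s / (h : ℝ)) ^ (x - 1)) * a k ^ x := by
          rw [mul_sum]
          refine sum_congr rfl fun k hk => ?_
          rw [prod_Ico_succ_top (mem_Icc.1 hk).2]
          ring
      _ ≤ _ := mul_le_mul_of_nonneg_left (ih fun i h1 h2 => ha i h1 (by lia)) (by positivity)

theorem prod_Icc_two_sub_eq_prod_Ico (f : ℝ → ℝ) {N k : ℕ} (hk : 1 ≤ k) (hN : 2 ≤ N) :
    ∏ j ∈ Icc 2 (N - k), f ((N : ℝ) - (j : ℝ)) = ∏ h ∈ Ico k (N - 1), f (h : ℝ) := by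
  refine prod_bij' (fun j _ => N - j) (fun h _ => N - h) ?_ ?_ ?_ ?_ ?_
  · intro j hj; simp only [mem_Icc, mem_Ico] at *; lia
  · intro j hj; simp only [mem_Icc, mem_Ico] at *; lia
  · intro j hj; simp only [mem_Icc] at *; lia
  · intro j hj; simp only [mem_Ico] at *; lia
  · intro j hj
    rw [mem_Icc] at hj
    rw [Nat.cast_sub (by lia)]

/-- Theorem 2.1 (real-variable content): tighter monogamy relation for the `α`-th power
(`0 ≤ α ≤ γ`).  `E` plays the role of `𝓔(ρ_{A|B_1⋯B_{N−1}})` and `Ei 1 ≥ ⋯ ≥ Ei (N−1) > 0`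
are the values `𝓔(ρ_{AB_i})` arranged in descending order; `hmono` is the `γ`-th monogamy
relation and `hqs` says `q ≤ s` where
`q = max_{h=1,…,N−2} h 𝓔_{h+1}^γ/(𝓔_1^γ+⋯+𝓔_h^γ)`. -/
theorem monogamy_alpha_le_gamma (γ α : ℝ) (hγ : 0 < γ) (hα0 : 0 ≤ α) (hαγ : α ≤ γ)
    (N : ℕ) (hN : 3 ≤ N) (E : ℝ) (Ei : ℕ → ℝ) (hE : 0 < E)
    (hpos : ∀ i, 1 ≤ i → i ≤ N - 1 → 0 < Ei i)
    (hdec : ∀ i, 1 ≤ i → i < N - 1 → Ei (i + 1) ≤ Ei i)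
    (hmono : E ^ γ ≥ ∑ i ∈ Icc 1 (N - 1), Ei i ^ γ)
    (s : ℝ)
    (hqs : ∀ h, 1 ≤ h → h ≤ N - 2 →
      (h : ℝ) * Ei (h + 1) ^ γ / (∑ i ∈ Icc 1 h, Ei i ^ γ) ≤ s)
    (hs1 : s ≤ 1) :
    E ^ α ≥
      (∑ k ∈ Icc 1 (N - 2), (1 + ((k : ℝ) - 1) / s) ^ (α / γ - 1) *
          (∏ j ∈ Icc 2 (N - k), (1 + s / ((N : ℝ) - (j : ℝ))) ^ (α / γ - 1)) * Ei k ^ α) +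
        (1 + ((N : ℝ) - 2) / s) ^ (α / γ - 1) * Ei (N - 1) ^ α := by
  have hs : 0 < s := by
    refine lt_of_lt_of_le ?_ (hqs 1 le_rfl (by lia))
    have h1 := hpos 1 (by lia) (by lia)
    have h2 := hpos 2 (by lia) (by lia)
    simp only [Icc_self, sum_singleton]
    norm_num
    positivity
  have hpow : ∀ {y : ℝ}, 0 ≤ y → (y ^ γ) ^ (α / γ) = y ^ α := fun hy => by
    rw [← Real.rpow_mul hy, mul_div_cancel₀ _ hγ.ne']
  have hx0 : 0 ≤ α / γ := by positivity
  have hnn : ∀ i, 1 ≤ i → i ≤ N - 1 → 0 ≤ Ei i ^ γ := fun i h1 h2 =>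
    Real.rpow_nonneg (hpos i h1 h2).le _
  have key := sum_weighted_rpow_le_rpow_sum hx0 ((div_le_one hγ).2 hαγ) hs
    (fun i => Ei i ^ γ) (m := N - 1) (by lia) hnn
  have hE' := Real.rpow_le_rpow
    (sum_nonneg fun i hi => hnn i (mem_Icc.1 hi).1 (mem_Icc.1 hi).2) hmono hx0
  rw [hpow hE.le] at hE'
  refine le_trans (le_of_eq ?_) (key.trans hE')
  have hN1 : N - 1 = (N - 2) + 1 := by lia
  have hcast : ((N - 2 : ℕ) : ℝ) = (N : ℝ) - 2 := by rw [Nat.cast_sub (by lia)]; norm_num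
  conv_rhs => rw [hN1, sum_Icc_succ_top (by lia)]
  rw [← hN1]
  congr 1
  · refine sum_congr rfl fun k hk => ?_
    rw [mem_Icc] at hk
    rw [hpow (hpos k hk.1 (by lia)).le,
      prod_Icc_two_sub_eq_prod_Ico (fun t => (1 + s / t) ^ (α / γ - 1)) hk.1 (by lia)]
  · rw [hpow (hpos (N - 1) (by lia) le_rfl).le, Ico_self, prod_empty, mul_one, hN1]
    push_cast
    rw [hcast, add_sub_cancel_right]
end

section
/- Let δ > 0 and 0 ≤ ω ≤ δ be reals, let N ≥ 3 be an integer, let E ≥ 0 and E_1 ≥ E_2 ≥ ⋯ ≥ E_{N−1} > 0 be real numbers satisfying E^δ ≤ ∑_{i=1}^{N−1} E_i^δ. For p = 2, …, N−1 set τ_p = (E_1^δ + ⋯ + E_{p−1}^δ)/E_p^δ. Then E^ω ≤ E_1^ω + ∑_{k=2}^{N−1} (k^(ω/δ) − (k−1)^(ω/δ))·E_k^ω + (ω/δ)·∑_{p=2}^{N−1} ((p−1)²/p²)·( τ_p^(ω/δ − 1) − (p−1)^(ω/δ − 1) )·E_p^ω. -/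
open Real Finset

theorem one_add_rpow_sub_one_le {x t : ℝ} (hx0 : 0 ≤ x) (hx1 : x ≤ 1) (ht : 0 < t) :
    (1 + t) ^ (x - 1) ≤ t ^ (x - 1) * (1 - (1 - x) / (1 + t)) := by
  have h1 : 0 < 1 + t := by linarith
  have hb := rpow_one_add_le_one_add_mul_self (s := -(1 / (1 + t))) (p := 1 - x)
    (by rw [neg_le_neg_iff, div_le_one h1]; linarith) (by linarith) (by linarith)
  have he : (1 + -(1 / (1 + t))) = t / (1 + t) := by field_simp; ring
  rw [he, Real.div_rpow ht.le h1.le] at hb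
  have hx : x - 1 = -(1 - x) := by ring
  rw [hx, Real.rpow_neg h1.le, Real.rpow_neg ht.le]
  have hp : 0 < t ^ (1 - x) := Real.rpow_pos_of_pos ht _
  calc ((1 + t) ^ (1 - x))⁻¹ = (t ^ (1 - x))⁻¹ * (t ^ (1 - x) / (1 + t) ^ (1 - x)) := by
        field_simp
    _ ≤ (t ^ (1 - x))⁻¹ * (1 + (1 - x) * -(1 / (1 + t))) := by gcongr
    _ = _ := by ring

theorem antitoneOn_one_add_rpow_sub {x m : ℝ} (hx0 : 0 ≤ x) (hx1 : x ≤ 1) (hm : 0 < m) :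
    AntitoneOn (fun t : ℝ ↦ (1 + t) ^ x - t ^ x - x * (m ^ 2 / (m + 1) ^ 2) * t ^ (x - 1))
      (Set.Ici m) := by
  have hd : ∀ t : ℝ, m ≤ t → HasDerivAt
      (fun t : ℝ ↦ (1 + t) ^ x - t ^ x - x * (m ^ 2 / (m + 1) ^ 2) * t ^ (x - 1))
      (1 * x * (1 + t) ^ (x - 1) - x * t ^ (x - 1)
        - x * (m ^ 2 / (m + 1) ^ 2) * ((x - 1) * t ^ (x - 1 - 1))) t := fun t ht ↦
    ((((hasDerivAt_id t).const_add 1).rpow_const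
      (Or.inl (by simp only [id]; linarith))).sub
      (Real.hasDerivAt_rpow_const (Or.inl (by linarith)))).sub
      ((Real.hasDerivAt_rpow_const (Or.inl (by linarith))).const_mul _)
  refine antitoneOn_of_deriv_nonpos (convex_Ici m)
    (fun t ht ↦ (hd t ht).continuousAt.continuousWithinAt)
    (fun t ht ↦ (hd t (interior_subset ht)).differentiableAt.differentiableWithinAt)
    fun t ht ↦ ?_
  have hmt : m ≤ t := interior_subset (s := Set.Ici m) ht
  have ht0 : 0 < t := hm.trans_le hmt
  rw [(hd t hmt).deriv, Real.rpow_sub_one ht0.ne' (x - 1)]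
  have hb := one_add_rpow_sub_one_le hx0 hx1 ht0
  have hp : 0 < t ^ (x - 1) := Real.rpow_pos_of_pos ht0 _
  have hc : m ^ 2 / (m + 1) ^ 2 / t ≤ 1 / (1 + t) := by
    rw [div_div, div_le_div_iff₀ (by positivity) (by linarith)]
    nlinarith [mul_nonneg hm.le (sub_nonneg.2 hmt)]
  have hk := mul_le_mul_of_nonneg_left hc (mul_nonneg hp.le (sub_nonneg.2 hx1))
  have key : (1 + t) ^ (x - 1) - t ^ (x - 1)
      + t ^ (x - 1) * (1 - x) * (m ^ 2 / (m + 1) ^ 2 / t) ≤ 0 := by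
    have : t ^ (x - 1) * (1 - (1 - x) / (1 + t))
      = t ^ (x - 1) - t ^ (x - 1) * (1 - x) * (1 / (1 + t)) := by ring
    linarith
  calc _ = x * ((1 + t) ^ (x - 1) - t ^ (x - 1)
      + t ^ (x - 1) * (1 - x) * (m ^ 2 / (m + 1) ^ 2 / t)) := by ring
    _ ≤ 0 := mul_nonpos_of_nonneg_of_nonpos hx0 key

theorem add_rpow_le_of_mul_le {x m S a : ℝ} (hx0 : 0 ≤ x) (hx1 : x ≤ 1) (hm : 0 < m)
    (ha : 0 < a) (hS : m * a ≤ S) :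
    (S + a) ^ x ≤ S ^ x + ((m + 1) ^ x - m ^ x) * a ^ x
      + x * (m ^ 2 / (m + 1) ^ 2 * ((S / a) ^ (x - 1) - m ^ (x - 1)) * a ^ x) := by
  have hmt : m ≤ S / a := (le_div_iff₀ ha).2 hS
  have ht : 0 < S / a := hm.trans_le hmt
  have h := antitoneOn_one_add_rpow_sub hx0 hx1 hm (Set.self_mem_Ici) (Set.mem_Ici.2 hmt) hmt
  have hS1 : S ^ x = (S / a) ^ x * a ^ x := by
    rw [← Real.mul_rpow ht.le ha.le, div_mul_cancel₀ _ ha.ne']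
  have hS2 : (S + a) ^ x = (1 + S / a) ^ x * a ^ x := by
    rw [← Real.mul_rpow (by linarith) ha.le]
    congr 1
    field_simp
    ring
  rw [hS1, hS2, add_comm m 1]
  simp only [add_comm m 1] at h
  have := mul_le_mul_of_nonneg_right h (Real.rpow_nonneg ha.le x)
  linarith

theorem mul_le_sum_Icc_of_succ_le {a : ℕ → ℝ} {n : ℕ}
    (hdec : ∀ i, 1 ≤ i → i < n → a (i + 1) ≤ a i) :
    (n : ℝ) * a n ≤ ∑ i ∈ Icc 1 n, a i := by
  induction n with
  | zero => simp
  | succ n ih =>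
    rw [sum_Icc_succ_top (by omega)]
    have ih := ih fun i h1 h2 ↦ hdec i h1 (by omega)
    rcases Nat.eq_zero_or_pos n with rfl | hn
    · simp
    have := mul_le_mul_of_nonneg_left (hdec n hn (by omega)) (Nat.cast_nonneg (α := ℝ) n)
    push_cast
    linarith

theorem sum_rpow_le_of_succ_le {x : ℝ} (hx0 : 0 ≤ x) (hx1 : x ≤ 1) {a : ℕ → ℝ} {n : ℕ}
    (hn : 1 ≤ n) (hpos : ∀ i, 1 ≤ i → i ≤ n → 0 < a i)
    (hdec : ∀ i, 1 ≤ i → i < n → a (i + 1) ≤ a i) :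
    (∑ i ∈ Icc 1 n, a i) ^ x ≤
      a 1 ^ x + (∑ k ∈ Icc 2 n, ((k : ℝ) ^ x - ((k : ℝ) - 1) ^ x) * a k ^ x) +
        x * ∑ p ∈ Icc 2 n, ((p : ℝ) - 1) ^ 2 / (p : ℝ) ^ 2 *
          (((∑ i ∈ Icc 1 (p - 1), a i) / a p) ^ (x - 1) - ((p : ℝ) - 1) ^ (x - 1)) * a p ^ x := by
  induction n, hn using Nat.le_induction with
  | base => simp
  | succ n hn ih =>
    have ih := ih (fun i h1 h2 ↦ hpos i h1 (by omega)) fun i h1 h2 ↦ hdec i h1 (by omega)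
    have hS : (n : ℝ) * a (n + 1) ≤ ∑ i ∈ Icc 1 n, a i :=
      (mul_le_mul_of_nonneg_left (hdec n hn (by omega)) (Nat.cast_nonneg n)).trans
        (mul_le_sum_Icc_of_succ_le fun i h1 h2 ↦ hdec i h1 (by omega))
    have hstep := add_rpow_le_of_mul_le hx0 hx1 (by exact_mod_cast hn)
      (hpos (n + 1) (by omega) le_rfl) hS
    rw [sum_Icc_succ_top (by omega), sum_Icc_succ_top (by omega), sum_Icc_succ_top (by omega)]
    simp only [Nat.cast_add, Nat.cast_one, add_sub_cancel_right, Nat.add_sub_cancel]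
    linarith

/-- Theorem 4.1 (real-variable content): tighter polygamy relation for the `ω`-th power
(`0 ≤ ω ≤ δ`).  `E` plays the role of `𝓔_a(ρ_{A|B_1⋯B_{N−1}})` and `Ei 1 ≥ ⋯ ≥ Ei (N−1) > 0`
are the values `𝓔_a(ρ_{AB_i})` arranged in descending order; `hpoly` is the `δ`-th polygamy
relation and `τ_p = (𝓔_1^δ+⋯+𝓔_{p−1}^δ)/𝓔_p^δ`. -/
theorem polygamy_omega_le_delta (δ ω : ℝ) (hδ : 0 < δ) (hω0 : 0 ≤ ω) (hωδ : ω ≤ δ)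
    (N : ℕ) (hN : 3 ≤ N) (E : ℝ) (Ei : ℕ → ℝ) (hE : 0 ≤ E)
    (hpos : ∀ i, 1 ≤ i → i ≤ N - 1 → 0 < Ei i)
    (hdec : ∀ i, 1 ≤ i → i < N - 1 → Ei (i + 1) ≤ Ei i)
    (hpoly : E ^ δ ≤ ∑ i ∈ Icc 1 (N - 1), Ei i ^ δ) :
    E ^ ω ≤
      Ei 1 ^ ω +
        (∑ k ∈ Icc 2 (N - 1), ((k : ℝ) ^ (ω / δ) - ((k : ℝ) - 1) ^ (ω / δ)) * Ei k ^ ω) +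
        ω / δ * ∑ p ∈ Icc 2 (N - 1), ((p : ℝ) - 1) ^ 2 / (p : ℝ) ^ 2 *
          (((∑ i ∈ Icc 1 (p - 1), Ei i ^ δ) / Ei p ^ δ) ^ (ω / δ - 1) -
              ((p : ℝ) - 1) ^ (ω / δ - 1)) * Ei p ^ ω := by
  have hpow : ∀ y : ℝ, 0 ≤ y → y ^ ω = (y ^ δ) ^ (ω / δ) := fun y hy ↦ by
    rw [← Real.rpow_mul hy, mul_div_cancel₀ _ hδ.ne']
  have hx0 : 0 ≤ ω / δ := div_nonneg hω0 hδ.le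
  have h := sum_rpow_le_of_succ_le (a := fun i ↦ Ei i ^ δ) hx0 ((div_le_one hδ).2 hωδ)
    (n := N - 1) (by omega) (fun i h1 h2 ↦ Real.rpow_pos_of_pos (hpos i h1 h2) δ)
    fun i h1 h2 ↦ Real.rpow_le_rpow (hpos (i + 1) (by omega) (by omega)).le (hdec i h1 h2) hδ.le
  have hEi : ∀ i ∈ Icc 2 (N - 1), Ei i ^ ω = (Ei i ^ δ) ^ (ω / δ) := fun i hi ↦
    hpow _ (hpos i (by grind) (by grind)).le
  rw [hpow E hE, hpow (Ei 1) (hpos 1 le_rfl (by omega)).le]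
  refine ((Real.rpow_le_rpow (Real.rpow_nonneg hE δ) hpoly hx0).trans h).trans_eq
    (congr_arg₂ _ (congr_arg _ (sum_congr rfl fun k hk ↦ ?_))
      (congr_arg _ (sum_congr rfl fun p hp ↦ ?_)))
  · rw [hEi k hk]
  · rw [hEi p hp]
end
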